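/- Let (X, v) and (Y, w) be regular pairs (X, Y skew-adjoint). Then there exists g in the unitary group G of ⟨·,·⟩ with g∘X∘g⁻¹ = Y and g(v) = w if and only if ⟨X^j v, v⟩ = ⟨Y^j w, w⟩ for every j ∈ ℕ and X and Y have the same characteristic polynomial. -/

import Mathlib

open Polynomial in
/-- A linear map sending `X ^ i v` to `Y ^ i w` for `i < dim V` does so for all `i`, as soon as
`X` and `Y` have the same characteristic polynomial. -/
lemma map_pow_apply_of_charpoly_eq {D V : Type*} [Field D] [AddCommGroup V] [Module D V]
    [FiniteDimensional D V] {X Y g : V →ₗ[D] V} {v w : V} (hXY : X.charpoly = Y.charpoly)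
    (hg : ∀ i < Module.finrank D V, g ((X ^ i) v) = (Y ^ i) w) (j : ℕ) :
    g ((X ^ j) v) = (Y ^ j) w := by
  have hmod : ∀ Z : V →ₗ[D] V, Z ^ j = aeval Z ((Polynomial.X ^ j : D[X]) %ₘ Z.charpoly) := fun Z ↦ by
    rw [aeval_modByMonic_eq_self_of_root Z.aeval_self_charpoly, map_pow, aeval_X]
  rw [hmod X, hmod Y, hXY]
  set p : D[X] := (Polynomial.X ^ j : D[X]) %ₘ Y.charpoly
  have hdeg : ∀ i ∈ p.support, i < Module.finrank D V := fun i hi ↦ by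
    have h := degree_modByMonic_lt (Polynomial.X ^ j : D[X]) Y.charpoly_monic
    rw [degree_eq_natDegree Y.charpoly_monic.ne_zero, Y.charpoly_natDegree] at h
    exact_mod_cast (le_degree_of_mem_supp i hi).trans_lt h
  simp only [aeval_eq_sum_range, LinearMap.sum_apply, map_sum, LinearMap.smul_apply, map_smul]
  refine Finset.sum_congr rfl fun i _ ↦ ?_
  by_cases hi : p.coeff i = 0
  · simp [hi]
  · rw [hg i (hdeg i (mem_support_iff.2 hi))]

/-- For a skew-adjoint operator, powers move across the form up to a sign. -/
lemma skew_pow_apply {D V : Type*} [Field D] [AddCommGroup V] [Module D V]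
    {B : V → V → D} {X : V →ₗ[D] V} (hX : ∀ a b : V, B (X a) b = - B a (X b))
    (j : ℕ) (a b : V) : B a ((X ^ j) b) = (-1) ^ j * B ((X ^ j) a) b := by
  induction j generalizing b with
  | zero => simp
  | succ j ih =>
    rw [pow_succ X, Module.End.mul_apply, ih, ← pow_succ, pow_succ' X, Module.End.mul_apply, hX]
    ring

/-- Two regular pairs `(X, v)`, `(Y, w)` (with `X, Y` skew-adjoint for the nondegenerate
hermitian form `⟨·,·⟩`) are conjugate under the unitary group of `⟨·,·⟩` if and only if
`⟨X^j v, v⟩ = ⟨Y^j w, w⟩` for all `j ∈ ℕ` and `X`, `Y` have the same characteristic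
polynomial. -/
theorem statement14 {D V : Type*} [Field D] [AddCommGroup V] [Module D V]
    [FiniteDimensional D V] {n : ℕ} (hn : 1 ≤ n) (hdim : Module.finrank D V = n)
    (σ : D ≃+* D) (hσ : ∀ d : D, σ (σ d) = d)
    (B : V → V → D)
    (hB1 : ∀ v v' w : V, B (v + v') w = B v w + B v' w)
    (hB2 : ∀ v w w' : V, B v (w + w') = B v w + B v w')
    (hB3 : ∀ (d d' : D) (v w : V), B (d • v) (d' • w) = d * σ d' * B v w)
    (hB4 : ∀ v w : V, B w v = σ (B v w))
    (hBnd : ∀ v : V, (∀ w : V, B v w = 0) → v = 0)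
    (X Y : V →ₗ[D] V)
    (hX : ∀ a b : V, B (X a) b = - B a (X b)) (hY : ∀ a b : V, B (Y a) b = - B a (Y b))
    (v w : V)
    (hregX : LinearIndependent D (fun i : Fin n => (X ^ (i : ℕ)) v) ∧
      Submodule.span D (Set.range fun i : Fin n => (X ^ (i : ℕ)) v) = ⊤)
    (hregY : LinearIndependent D (fun i : Fin n => (Y ^ (i : ℕ)) w) ∧
      Submodule.span D (Set.range fun i : Fin n => (Y ^ (i : ℕ)) w) = ⊤) :
    (∃ g : V ≃ₗ[D] V, (∀ a b : V, B (g a) (g b) = B a b) ∧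
        g.toLinearMap ∘ₗ X ∘ₗ g.symm.toLinearMap = Y ∧ g v = w) ↔
      ((∀ j : ℕ, B ((X ^ j) v) v = B ((Y ^ j) w) w) ∧ X.charpoly = Y.charpoly) := by
  have conj_pow : ∀ g : V ≃ₗ[D] V, (∀ a, g (X a) = Y (g a)) →
      ∀ (j : ℕ) (a : V), g ((X ^ j) a) = (Y ^ j) (g a) := fun g hg j ↦ by
    induction j with
    | zero => simp
    | succ j ih => intro a; rw [pow_succ, pow_succ, Module.End.mul_apply, ih, hg]; rfl
  constructor
  · rintro ⟨g, hgB, hgX, rfl⟩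
    have hg : ∀ a, g (X a) = Y (g a) := fun a ↦ by simp [← hgX]
    refine ⟨fun j ↦ by rw [← conj_pow g hg, hgB], ?_⟩
    rw [← hgX]
    exact (LinearEquiv.charpoly_conj g X).symm
  · rintro ⟨hmom, hchar⟩
    let bX := Module.Basis.mk hregX.1 hregX.2.ge
    let bY := Module.Basis.mk hregY.1 hregY.2.ge
    let g : V ≃ₗ[D] V := bX.equiv bY (Equiv.refl _)
    have hg_pow : ∀ j : ℕ, g ((X ^ j) v) = (Y ^ j) w :=
      map_pow_apply_of_charpoly_eq (g := g.toLinearMap) hchar fun i hi ↦ by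
        simpa [bX, bY, g] using bX.equiv_apply ⟨i, hdim ▸ hi⟩ bY (Equiv.refl _)
    have hgX : g.toLinearMap ∘ₗ X = Y ∘ₗ g.toLinearMap := bX.ext fun i ↦ by
      simp only [bX, Module.Basis.mk_apply, LinearMap.comp_apply, LinearEquiv.coe_coe]
      rw [hg_pow, ← Module.End.mul_apply, ← Module.End.mul_apply, ← pow_succ', ← pow_succ', hg_pow]
    have left_smul : ∀ (d : D) (a b : V), B (d • a) b = RingHom.id D d • B a b := fun d a b ↦ by
      simpa using hB3 d 1 a b
    have right_smul : ∀ (d : D) (a b : V), B a (d • b) = (σ : D →+* D) d • B a b := fun d a b ↦ by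
      simpa using hB3 1 d a b
    let F : V →ₗ[D] V →ₛₗ[(σ : D →+* D)] D :=
      LinearMap.mk₂'ₛₗ (RingHom.id D) (σ : D →+* D) B hB1 left_smul hB2 right_smul
    have hFB : ∀ a b, F a b = B a b := fun _ _ ↦ rfl
    have hF : (F ∘ₗ g.toLinearMap).compl₂ g.toLinearMap = F :=
      bX.ext fun i ↦ bX.ext fun j ↦ by
        simp only [bX, Module.Basis.mk_apply, LinearMap.compl₂_apply, LinearMap.comp_apply,
          LinearEquiv.coe_coe, hg_pow, hFB]
        rw [skew_pow_apply hY, skew_pow_apply hX, ← Module.End.mul_apply, ← Module.End.mul_apply,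
          ← pow_add, ← pow_add, hmom]
    refine ⟨g, fun a b ↦ LinearMap.congr_fun₂ hF a b, ?_, by simpa using hg_pow 0⟩
    rw [← LinearMap.comp_assoc, hgX]
    ext a
    simp
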